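/- Let (c,d) ⊂ ℝ be a bounded interval and (f_ε) a family of continuous functions on [c,d] such that (i) f_ε² ∈ W^{1,1}(c,d) with ‖f_ε²‖_{W^{1,1}} ≤ M uniformly in ε, and (ii) f_ε ⇀ f₀ weakly in L¹(c,d). Then f_ε → f₀ strongly in L^p(c,d) for every p ∈ [1,∞). -/

import Mathlib

open MeasureTheory intervalIntegral

/-- `F` belongs to `W^{1,1}(c,d)` with weak derivative `G`: both are integrable on
`(c,d)` and `F` is the indefinite integral of `G` (for continuous `F` this is the
usual absolutely continuous representative characterization). -/
def HasWeakDerivOn (F G : ℝ → ℝ) (c d : ℝ) : Prop :=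
  IntervalIntegrable F volume c d ∧ IntervalIntegrable G volume c d ∧
    ∀ x ∈ Set.Icc c d, F x = F c + ∫ t in c..x, G t

open Set in
lemma aux_sq_diff {c d : ℝ} {u g : ℝ → ℝ}
    (hW : HasWeakDerivOn (fun x => (u x) ^ 2) g c d) {x y : ℝ} (hx : x ∈ Icc c d)
    (hy : y ∈ Icc c d) (hxy : x ≤ y) :
    |u y ^ 2 - u x ^ 2| ≤ ∫ t in x..y, |g t| := by
  obtain ⟨_, hg, hF⟩ := hW
  have hcd : c ≤ d := hx.1.trans hx.2
  have hsub : ∀ a ∈ Icc c d, IntervalIntegrable g volume c a := by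
    intro a ha
    refine hg.mono_set ?_
    rw [uIcc_of_le ha.1, uIcc_of_le hcd]
    exact Icc_subset_Icc le_rfl ha.2
  have h1 := hF x hx
  have h2 := hF y hy
  simp only at h1 h2
  have h3 := integral_interval_sub_left (hsub y hy) (hsub x hx)
  have h4 : u y ^ 2 - u x ^ 2 = ∫ t in x..y, g t := by linarith
  rw [h4]
  exact abs_integral_le_integral_abs hxy

open Set in
lemma aux_abs_int {c d : ℝ} {g : ℝ → ℝ} (hg : IntervalIntegrable g volume c d) {x y : ℝ}
    (hx : x ∈ Icc c d) (hy : y ∈ Icc c d) :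
    IntervalIntegrable (fun t => |g t|) volume x y := by
  have hcd : c ≤ d := hx.1.trans hx.2
  refine hg.abs.mono_set ?_
  rw [uIcc_of_le hcd]
  exact uIcc_subset_Icc hx hy

open Set in
lemma aux_osc {c d : ℝ} {u g : ℝ → ℝ} (hu : ContinuousOn u (Icc c d))
    (hW : HasWeakDerivOn (fun x => (u x) ^ 2) g c d) {x y : ℝ} (hx : x ∈ Icc c d)
    (hy : y ∈ Icc c d) (hxy : x ≤ y) :
    (u y - u x) ^ 2 ≤ 2 * ∫ t in x..y, |g t| := by
  have hd := aux_sq_diff hW hx hy hxy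
  have hnn : 0 ≤ ∫ t in x..y, |g t| := integral_nonneg hxy (fun t _ => abs_nonneg _)
  by_cases hs : 0 ≤ u x * u y
  · have : (u y - u x) ^ 2 ≤ |u y ^ 2 - u x ^ 2| := by
      have e : |u y ^ 2 - u x ^ 2| = |u y - u x| * |u y + u x| := by
        rw [← abs_mul]; ring_nf
      rw [e, ← sq_abs, sq]
      apply mul_le_mul_of_nonneg_left _ (abs_nonneg _)
      apply sq_le_sq.1
      nlinarith
    linarith
  · push Not at hs
    have hz : ∃ z ∈ Icc x y, u z = 0 := by
      have hc : ContinuousOn u (uIcc x y) := hu.mono (uIcc_subset_Icc hx hy)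
      have h0 : (0 : ℝ) ∈ uIcc (u x) (u y) := by
        rw [mem_uIcc]
        rcases mul_neg_iff.1 hs with h | h
        · right; exact ⟨h.2.le, h.1.le⟩
        · left; exact ⟨h.1.le, h.2.le⟩
      obtain ⟨z, hz, hz0⟩ := intermediate_value_uIcc hc h0
      rw [uIcc_of_le hxy] at hz
      exact ⟨z, hz, hz0⟩
    obtain ⟨z, hz, hz0⟩ := hz
    have hzI : z ∈ Icc c d := ⟨hx.1.trans hz.1, hz.2.trans hy.2⟩
    have h1 := aux_sq_diff hW hx hzI hz.1
    have h2 := aux_sq_diff hW hzI hy hz.2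
    have h3 := integral_add_adjacent_intervals (aux_abs_int hW.2.1 hx hzI)
      (aux_abs_int hW.2.1 hzI hy)
    rw [hz0] at h1 h2
    have h1' := (abs_le.1 h1).1
    have h2' := (abs_le.1 h2).2
    nlinarith [sq_nonneg (u y + u x)]

open Set in
lemma aux_osc' {c d : ℝ} {u g : ℝ → ℝ} (hu : ContinuousOn u (Icc c d))
    (hW : HasWeakDerivOn (fun x => (u x) ^ 2) g c d) {a b η : ℝ} (hη : 0 < η)
    (ha : a ∈ Icc c d) (hb : b ∈ Icc c d) {x y : ℝ} (hx : x ∈ Icc a b) (hy : y ∈ Icc a b) :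
    |u x - u y| ≤ η + (∫ t in a..b, |g t|) / η := by
  wlog hxy : x ≤ y generalizing x y
  · rw [abs_sub_comm]; exact this hy hx (le_of_not_ge hxy)
  have hxI : x ∈ Icc c d := ⟨ha.1.trans hx.1, hx.2.trans hb.2⟩
  have hyI : y ∈ Icc c d := ⟨ha.1.trans hy.1, hy.2.trans hb.2⟩
  have h := aux_osc hu hW hxI hyI hxy
  have hm : ∫ t in x..y, |g t| ≤ ∫ t in a..b, |g t| :=
    integral_mono_interval hx.1 hxy hy.2 (Filter.Eventually.of_forall fun t => abs_nonneg _)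
      (aux_abs_int hW.2.1 ha hb)
  set w := ∫ t in a..b, |g t|
  have hw : 0 ≤ w := integral_nonneg (hx.1.trans hx.2) (fun t _ => abs_nonneg _)
  apply abs_le_of_sq_le_sq _ (by positivity)
  have e : (η + w / η) ^ 2 = η ^ 2 + 2 * w + (w / η) ^ 2 := by
    field_simp
    ring
  rw [e]
  nlinarith [sq_nonneg η, sq_nonneg (w / η)]

open Set in
lemma aux_int {w : ℝ → ℝ} {a b E : ℝ} (hab : a < b) (hw : ContinuousOn w (Icc a b))
    (hE : ∀ x ∈ Icc a b, ∀ y ∈ Icc a b, |w x - w y| ≤ E) :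
    ∫ x in a..b, |w x| ≤ (b - a) * E + |∫ x in a..b, w x| := by
  have hi : IntervalIntegrable w volume a b := hw.intervalIntegrable_of_Icc hab.le
  have hp : ∀ x ∈ Icc a b, |w x| ≤ E + |∫ x in a..b, w x| / (b - a) := by
    intro x hx
    have hba : 0 < b - a := sub_pos.2 hab
    have h1 : ∫ y in a..b, (w x - w y) = (b - a) * w x - ∫ y in a..b, w y := by
      rw [intervalIntegral.integral_sub (by simp) hi]; simp
    have h2 : |∫ y in a..b, (w x - w y)| ≤ E * |b - a| := by
      rw [← Real.norm_eq_abs]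
      apply intervalIntegral.norm_integral_le_of_norm_le_const
      intro y hy
      rw [uIoc_of_le hab.le] at hy
      exact hE x hx y ⟨hy.1.le, hy.2⟩
    rw [h1, abs_of_pos hba] at h2
    have h3 : |(b - a) * w x| ≤ E * (b - a) + |∫ x in a..b, w x| := by
      have := abs_sub_abs_le_abs_sub ((b - a) * w x) (∫ y in a..b, w y)
      linarith
    rw [abs_mul, abs_of_pos hba] at h3
    have : E + |∫ x in a..b, w x| / (b - a) = (E * (b - a) + |∫ x in a..b, w x|) / (b - a) := by
      field_simp
    rw [this, le_div_iff₀ hba]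
    linarith
  have h := intervalIntegral.integral_mono_on hab.le hi.abs
    (intervalIntegrable_const (c := E + |∫ x in a..b, w x| / (b - a))) hp
  refine h.trans (le_of_eq ?_)
  have hba : b - a ≠ 0 := (sub_pos.2 hab).ne'
  simp only [intervalIntegral.integral_const, smul_eq_mul]
  field_simp

open Set in
lemma aux_pair {c d : ℝ} (hcd : c < d) {u v gu gv : ℝ → ℝ} {M : ℝ}
    (hu : ContinuousOn u (Icc c d)) (hv : ContinuousOn v (Icc c d))
    (hWu : HasWeakDerivOn (fun x => (u x) ^ 2) gu c d)
    (hWv : HasWeakDerivOn (fun x => (v x) ^ 2) gv c d)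
    (hMu : ∫ x in c..d, |gu x| ≤ M) (hMv : ∫ x in c..d, |gv x| ≤ M)
    (n : ℕ) (hn : 0 < n) (a : ℕ → ℝ) (ha : ∀ i, a i = c + i * ((d - c) / n))
    (η : ℝ) (hη : 0 < η) (hη2 : η ^ 2 = (d - c) / n) :
    ∫ x in c..d, |u x - v x| ≤ (2 * (d - c) + 2 * M) * η
      + ∑ i ∈ Finset.range n, |∫ x in a i..a (i + 1), (u x - v x)| := by
  have hn' : (0 : ℝ) < n := by exact_mod_cast hn
  have hδ : 0 < (d - c) / n := div_pos (sub_pos.2 hcd) hn'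
  have hstep : ∀ i, a (i + 1) - a i = η ^ 2 := by
    intro i; rw [ha, ha, hη2]; push_cast; ring
  have ha0 : a 0 = c := by simp [ha]
  have han : a n = d := by rw [ha]; field_simp; ring
  have hmem : ∀ i ≤ n, a i ∈ Icc c d := by
    intro i hi
    have hi' : (i : ℝ) ≤ n := by exact_mod_cast hi
    refine ⟨by rw [ha]; have := mul_nonneg (Nat.cast_nonneg (α := ℝ) i) hδ.le; linarith, ?_⟩
    rw [← han, ha, ha]
    gcongr
  have hlt : ∀ i, a i < a (i + 1) := by
    intro i; have := hstep i; have := pow_pos hη 2; linarith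
  have hwc : ContinuousOn (fun x => u x - v x) (Icc c d) := hu.sub hv
  have hsum : ∀ w : ℝ → ℝ, IntervalIntegrable w volume c d →
      ∑ i ∈ Finset.range n, ∫ x in a i..a (i + 1), |w x| = ∫ x in c..d, |w x| := by
    intro w hw
    rw [intervalIntegral.sum_integral_adjacent_intervals, ha0, han]
    intro i hi
    exact aux_abs_int hw (hmem i hi.le) (hmem (i + 1) hi)
  rw [← hsum (fun x => u x - v x) (hwc.intervalIntegrable_of_Icc hcd.le)]
  have hterm : ∀ i ∈ Finset.range n, ∫ x in a i..a (i + 1), |u x - v x| ≤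
      (2 * η ^ 3 + η * (∫ x in a i..a (i + 1), |gu x|) + η * (∫ x in a i..a (i + 1), |gv x|))
       + |∫ x in a i..a (i + 1), (u x - v x)| := by
    intro i hi
    rw [Finset.mem_range] at hi
    have h1 := hmem i hi.le
    have h2 := hmem (i + 1) hi
    have h := aux_int (w := fun x => u x - v x)
      (E := (η + (∫ t in a i..a (i + 1), |gu t|) / η) +
        (η + (∫ t in a i..a (i + 1), |gv t|) / η)) (hlt i)
      (hwc.mono (Icc_subset_Icc h1.1 h2.2)) (by
        intro x hx y hy
        have e1 := aux_osc' hu hWu hη h1 h2 hx hy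
        have e2 := aux_osc' hv hWv hη h1 h2 hx hy
        have e3 : u x - v x - (u y - v y) = (u x - u y) - (v x - v y) := by ring
        rw [e3]
        exact (abs_sub _ _).trans (add_le_add e1 e2))
    refine h.trans (le_of_eq ?_)
    rw [hstep]
    congr 1
    field_simp
    ring
  refine (Finset.sum_le_sum hterm).trans ?_
  simp only [Finset.sum_add_distrib, ← Finset.mul_sum]
  rw [hsum gu hWu.2.1, hsum gv hWv.2.1]
  simp only [Finset.sum_const, Finset.card_range, nsmul_eq_mul]
  have e : 2 * ((n : ℝ) * η ^ 3) = 2 * (d - c) * η := by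
    have : (n : ℝ) * η ^ 2 = d - c := by rw [hη2]; field_simp
    linear_combination (2 * η) * this
  rw [e]
  nlinarith

open Set in
lemma aux_bdd {c d : ℝ} (hcd : c < d) {u g : ℝ → ℝ} {M : ℝ}
    (hW : HasWeakDerivOn (fun x => (u x) ^ 2) g c d)
    (hM : (∫ x in c..d, |(u x) ^ 2|) + (∫ x in c..d, |g x|) ≤ M) :
    ∀ x ∈ Icc c d, |u x| ≤ √(M / (d - c) + M) := by
  intro x hx
  have hba : 0 < d - c := sub_pos.2 hcd
  apply Real.abs_le_sqrt
  have hc : c ∈ Icc c d := ⟨le_rfl, hcd.le⟩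
  have hd : d ∈ Icc c d := ⟨hcd.le, le_rfl⟩
  have hg0 : 0 ≤ ∫ x in c..d, |g x| := integral_nonneg hcd.le (fun t _ => abs_nonneg _)
  have hu0 : 0 ≤ ∫ x in c..d, |(u x) ^ 2| := integral_nonneg hcd.le (fun t _ => abs_nonneg _)
  have hp : ∀ y ∈ Icc c d, u x ^ 2 - M ≤ |(u y) ^ 2| := by
    intro y hy
    rw [abs_of_nonneg (sq_nonneg (u y))]
    rcases le_total x y with h | h
    · have h1 := (abs_le.1 (aux_sq_diff hW hx hy h)).1
      have hm : ∫ t in x..y, |g t| ≤ ∫ t in c..d, |g t| :=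
        integral_mono_interval hx.1 h hy.2 (Filter.Eventually.of_forall fun t => abs_nonneg _)
          (aux_abs_int hW.2.1 hc hd)
      linarith
    · have h1 := (abs_le.1 (aux_sq_diff hW hy hx h)).2
      have hm : ∫ t in y..x, |g t| ≤ ∫ t in c..d, |g t| :=
        integral_mono_interval hy.1 h hx.2 (Filter.Eventually.of_forall fun t => abs_nonneg _)
          (aux_abs_int hW.2.1 hc hd)
      linarith
  have h := intervalIntegral.integral_mono_on hcd.le
    (intervalIntegrable_const (c := u x ^ 2 - M)) hW.1.abs hp
  simp only [intervalIntegral.integral_const, smul_eq_mul] at h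
  have : u x ^ 2 - M ≤ M / (d - c) := by
    rw [le_div_iff₀ hba]; linarith
  linarith

open Set in
lemma aux_sign {c d : ℝ} (hcd : c < d) {w : ℝ → ℝ} (hw : IntervalIntegrable w volume c d) :
    ∃ φ : ℝ → ℝ, Measurable φ ∧ (∀ x, |φ x| ≤ 1) ∧
      ∫ x in c..d, w x * φ x = ∫ x in c..d, |w x| := by
  have hm : AEStronglyMeasurable w (volume.restrict (Ioc c d)) := hw.1.aestronglyMeasurable
  have hmm : Measurable (hm.mk w) := hm.stronglyMeasurable_mk.measurable
  refine ⟨fun x => if 0 ≤ hm.mk w x then 1 else -1, ?_, ?_, ?_⟩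
  · exact Measurable.ite (measurableSet_le measurable_const hmm) measurable_const measurable_const
  · intro x; dsimp only; split_ifs <;> simp
  · rw [intervalIntegral.integral_of_le hcd.le, intervalIntegral.integral_of_le hcd.le]
    apply MeasureTheory.integral_congr_ae
    filter_upwards [hm.ae_eq_mk] with x hx
    rw [← hx]
    split_ifs with h
    · rw [abs_of_nonneg h, mul_one]
    · rw [abs_of_neg (not_le.1 h)]; ring

open Set in
lemma aux_ind {c d a b : ℝ} (hcd : c < d) (ha : a ∈ Icc c d) (hb : b ∈ Icc c d) (hab : a ≤ b)
    (h : ℝ → ℝ) :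
    ∫ x in c..d, h x * (Ioc a b).indicator (fun _ => (1 : ℝ)) x = ∫ x in a..b, h x := by
  rw [intervalIntegral.integral_of_le hcd.le, intervalIntegral.integral_of_le hab]
  have : (fun x => h x * (Ioc a b).indicator (fun _ => (1 : ℝ)) x) = (Ioc a b).indicator h := by
    ext x
    by_cases hx : x ∈ Ioc a b <;> simp [hx]
  rw [this, setIntegral_indicator measurableSet_Ioc,
    inter_eq_self_of_subset_right (Ioc_subset_Ioc ha.1 hb.2)]

open Set Filter in
lemma aux_L1 (c d : ℝ) (hcd : c < d) (f : ℕ → ℝ → ℝ) (f₀ : ℝ → ℝ)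
    (g : ℕ → ℝ → ℝ) (M : ℝ)
    (hcont : ∀ k, ContinuousOn (f k) (Set.Icc c d))
    (hW11 : ∀ k, HasWeakDerivOn (fun x => (f k x) ^ 2) (g k) c d)
    (hM : ∀ k, (∫ x in c..d, |g k x|) ≤ M)
    (hf₀ : IntervalIntegrable f₀ volume c d)
    (hweak : ∀ φ : ℝ → ℝ, Measurable φ → (∃ K, ∀ x, |φ x| ≤ K) →
      Filter.Tendsto (fun k => ∫ x in c..d, f k x * φ x) Filter.atTop
        (nhds (∫ x in c..d, f₀ x * φ x))) :
    Tendsto (fun k => ∫ x in c..d, |f k x - f₀ x|) atTop (nhds 0) := by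
  have hM0 : 0 ≤ M := (integral_nonneg hcd.le (fun t _ => abs_nonneg _)).trans (hM 0)
  have hba : 0 < d - c := sub_pos.2 hcd
  have hfi : ∀ k, IntervalIntegrable (f k) volume c d :=
    fun k => (hcont k).intervalIntegrable_of_Icc hcd.le
  have hsubint : ∀ w : ℝ → ℝ, IntervalIntegrable w volume c d → ∀ a ∈ Icc c d, ∀ b ∈ Icc c d,
      IntervalIntegrable w volume a b := by
    intro w hw a ha b hb
    refine hw.mono_set ?_
    rw [uIcc_of_le hcd.le]
    exact uIcc_subset_Icc ha hb
  have hloc : ∀ a ∈ Icc c d, ∀ b ∈ Icc c d, a ≤ b →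
      Tendsto (fun k => ∫ x in a..b, f k x) atTop (nhds (∫ x in a..b, f₀ x)) := by
    intro a ha b hb hab
    have h := hweak ((Ioc a b).indicator (fun _ => (1 : ℝ)))
      (measurable_const.indicator measurableSet_Ioc) ⟨1, fun x => by
        by_cases hx : x ∈ Ioc a b <;> simp [hx]⟩
    simpa only [aux_ind hcd ha hb hab] using h
  -- key bound
  have hkey : ∀ n : ℕ, 0 < n → ∃ R : ℕ → ℝ, Tendsto R atTop (nhds 0) ∧
      ∀ k, ∫ x in c..d, |f k x - f₀ x| ≤ (2 * (d - c) + 2 * M) * √((d - c) / n) + R k := by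
    intro n hn
    have hn' : (0 : ℝ) < n := by exact_mod_cast hn
    have hδ : 0 < (d - c) / n := div_pos hba hn'
    set a : ℕ → ℝ := fun i => c + i * ((d - c) / n) with ha
    have hmem : ∀ i ≤ n, a i ∈ Icc c d := by
      intro i hi
      have hi' : (i : ℝ) ≤ n := by exact_mod_cast hi
      have han : a n = d := by simp only [ha]; field_simp; ring
      have h0 := mul_nonneg (Nat.cast_nonneg (α := ℝ) i) hδ.le
      refine ⟨by simp only [ha]; linarith, ?_⟩
      rw [← han]
      simp only [ha]
      gcongr
    have hle : ∀ i, a i ≤ a (i + 1) := by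
      intro i; simp only [ha]; push_cast; nlinarith
    refine ⟨fun k => ∑ i ∈ Finset.range n, |∫ x in a i..a (i + 1), (f k x - f₀ x)|, ?_, ?_⟩
    · rw [← Finset.sum_const_zero (s := Finset.range n)]
      apply tendsto_finsetSum
      intro i hi
      rw [Finset.mem_range] at hi
      have h := (hloc _ (hmem i hi.le) _ (hmem (i + 1) hi) (hle i)).sub_const
        (∫ x in a i..a (i + 1), f₀ x)
      rw [sub_self] at h
      have h' := h.abs
      rw [abs_zero] at h'
      refine h'.congr fun k => ?_
      rw [intervalIntegral.integral_sub
        (hsubint _ (hfi k) _ (hmem i hi.le) _ (hmem (i + 1) hi))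
        (hsubint _ hf₀ _ (hmem i hi.le) _ (hmem (i + 1) hi))]
    · intro k
      obtain ⟨φ, hφm, hφ1, hφ⟩ := aux_sign hcd ((hfi k).sub hf₀)
      have hmulint : ∀ w : ℝ → ℝ, IntervalIntegrable w volume c d →
          IntervalIntegrable (fun x => w x * φ x) volume c d := by
        intro w hw
        rw [intervalIntegrable_iff] at hw ⊢
        exact hw.mul_bdd (c := 1) hφm.aestronglyMeasurable
          (Eventually.of_forall fun x => hφ1 x)
      have hlim : Tendsto (fun j => ∫ x in c..d, (f k x - f j x) * φ x) atTop
          (nhds (∫ x in c..d, |f k x - f₀ x|)) := by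
        rw [← hφ]
        have h := (hweak φ hφm ⟨1, hφ1⟩).const_sub (∫ x in c..d, f k x * φ x)
        rw [← intervalIntegral.integral_sub (hmulint _ (hfi k)) (hmulint _ hf₀)] at h
        simp only [← sub_mul] at h
        refine h.congr fun j => ?_
        rw [← intervalIntegral.integral_sub (hmulint _ (hfi k)) (hmulint _ (hfi j))]
        simp only [← sub_mul]
      have hlim2 : Tendsto (fun j => (2 * (d - c) + 2 * M) * √((d - c) / n) +
          ∑ i ∈ Finset.range n, |∫ x in a i..a (i + 1), (f k x - f j x)|) atTop
          (nhds ((2 * (d - c) + 2 * M) * √((d - c) / n) +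
          ∑ i ∈ Finset.range n, |∫ x in a i..a (i + 1), (f k x - f₀ x)|)) := by
        apply Tendsto.const_add
        apply tendsto_finsetSum
        intro i hi
        rw [Finset.mem_range] at hi
        apply Tendsto.abs
        have h := (hloc _ (hmem i hi.le) _ (hmem (i + 1) hi) (hle i)).const_sub
          (∫ x in a i..a (i + 1), f k x)
        rw [← intervalIntegral.integral_sub
          (hsubint _ (hfi k) _ (hmem i hi.le) _ (hmem (i + 1) hi))
          (hsubint _ hf₀ _ (hmem i hi.le) _ (hmem (i + 1) hi))] at h
        refine h.congr fun j => ?_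
        rw [← intervalIntegral.integral_sub
          (hsubint _ (hfi k) _ (hmem i hi.le) _ (hmem (i + 1) hi))
          (hsubint _ (hfi j) _ (hmem i hi.le) _ (hmem (i + 1) hi))]
      refine le_of_tendsto_of_tendsto' hlim hlim2 fun j => ?_
      refine le_trans ?_ (aux_pair hcd (hcont k) (hcont j) (hW11 k) (hW11 j) (hM k) (hM j) n hn a
        (fun i => rfl) _ (Real.sqrt_pos.2 hδ) (Real.sq_sqrt hδ.le))
      refine intervalIntegral.integral_mono_on hcd.le (hmulint _ ((hfi k).sub (hfi j)))
        ((hfi k).sub (hfi j)).abs fun x _ => ?_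
      refine (le_abs_self _).trans ?_
      rw [abs_mul]
      exact mul_le_of_le_one_right (abs_nonneg _) (hφ1 x)
  have hsm : Tendsto (fun n : ℕ => (2 * (d - c) + 2 * M) * √((d - c) / n)) atTop (nhds 0) := by
    have h1 : Tendsto (fun n : ℕ => (d - c) / (n : ℝ)) atTop (nhds 0) :=
      tendsto_const_div_atTop_nhds_zero_nat _
    have h2 := (Real.continuous_sqrt.tendsto 0).comp h1
    simpa using h2.const_mul (2 * (d - c) + 2 * M)
  rw [Metric.tendsto_atTop]
  intro ε hε
  obtain ⟨n, hn1, hn2⟩ := ((hsm.eventually (gt_mem_nhds (half_pos hε))).and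
    (eventually_gt_atTop 0)).exists
  obtain ⟨R, hR, hRk⟩ := hkey n hn2
  obtain ⟨N, hN⟩ := eventually_atTop.1 (hR.eventually (gt_mem_nhds (half_pos hε)))
  refine ⟨N, fun k hk => ?_⟩
  rw [Real.dist_eq, sub_zero, abs_of_nonneg (integral_nonneg hcd.le (fun t _ => abs_nonneg _))]
  have := hRk k
  have := hN k hk
  linarith

/-- If `f_ε` are continuous on `[c,d]`, `f_ε²` are bounded in `W^{1,1}(c,d)` and
`f_ε ⇀ f₀` weakly in `L¹(c,d)`, then `f_ε → f₀` strongly in every `L^p`, `p < ∞`. -/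
theorem stmt10 (c d : ℝ) (hcd : c < d) (f : ℕ → ℝ → ℝ) (f₀ : ℝ → ℝ)
    (g : ℕ → ℝ → ℝ) (M : ℝ)
    (hcont : ∀ k, ContinuousOn (f k) (Set.Icc c d))
    (hW11 : ∀ k, HasWeakDerivOn (fun x => (f k x) ^ 2) (g k) c d)
    (hbound : ∀ k, (∫ x in c..d, |(f k x) ^ 2|) + (∫ x in c..d, |g k x|) ≤ M)
    (hf₀ : IntervalIntegrable f₀ volume c d)
    (hweak : ∀ φ : ℝ → ℝ, Measurable φ → (∃ K, ∀ x, |φ x| ≤ K) →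
      Filter.Tendsto (fun k => ∫ x in c..d, f k x * φ x) Filter.atTop
        (nhds (∫ x in c..d, f₀ x * φ x))) :
    ∀ p : ℝ, 1 ≤ p →
      Filter.Tendsto (fun k => ∫ x in c..d, |f k x - f₀ x| ^ p) Filter.atTop
        (nhds 0) := by
  have hg0 : ∀ k, 0 ≤ ∫ x in c..d, |g k x| :=
    fun k => integral_nonneg hcd.le (fun t _ => abs_nonneg _)
  have hu0 : ∀ k, 0 ≤ ∫ x in c..d, |(f k x) ^ 2| :=
    fun k => integral_nonneg hcd.le (fun t _ => abs_nonneg _)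
  have hL1 := aux_L1 c d hcd f f₀ g M hcont hW11
    (fun k => by have := hbound k; have := hu0 k; linarith) hf₀ hweak
  have hB : ∀ k, ∀ x ∈ Set.Icc c d, |f k x| ≤ √(M / (d - c) + M) :=
    fun k => aux_bdd hcd (hW11 k) (hbound k)
  set C := √(M / (d - c) + M) with hC
  have hC0 : 0 ≤ C := Real.sqrt_nonneg _
  have hfi : ∀ k, IntervalIntegrable (f k) volume c d :=
    fun k => (hcont k).intervalIntegrable_of_Icc hcd.le
  have hmaxi : IntervalIntegrable (fun x => max (|f₀ x| - C) 0) volume c d := by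
    have h := hf₀.abs.sub (intervalIntegrable_const (c := C))
    rw [intervalIntegrable_iff] at h ⊢
    exact h.pos_part
  have hzero : ∫ x in c..d, max (|f₀ x| - C) 0 = 0 := by
    apply le_antisymm
    · refine ge_of_tendsto' hL1 fun k => ?_
      refine intervalIntegral.integral_mono_on hcd.le hmaxi ((hfi k).sub hf₀).abs fun x hx => ?_
      apply max_le _ (abs_nonneg _)
      have h1 := hB k x hx
      have h2 := abs_sub_abs_le_abs_sub (f₀ x) (f k x)
      rw [abs_sub_comm] at h2
      linarith
    · exact integral_nonneg hcd.le (fun t _ => le_max_right _ _)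
  have hf₀b : ∀ᵐ x ∂(volume.restrict (Set.Ioc c d)), |f₀ x| ≤ C := by
    rw [intervalIntegral.integral_of_le hcd.le, MeasureTheory.integral_eq_zero_iff_of_nonneg
      (f := fun x => max (|f₀ x| - C) 0) (fun t => le_max_right (|f₀ t| - C) (0 : ℝ)) hmaxi.1] at hzero
    filter_upwards [hzero] with x hx
    have h : max (|f₀ x| - C) 0 = 0 := hx
    have := max_eq_right_iff.1 h
    linarith
  intro p hp
  have hlim := hL1.const_mul ((2 * C) ^ (p - 1))
  rw [mul_zero] at hlim
  refine squeeze_zero (fun k => integral_nonneg hcd.le (fun t _ => by positivity)) (fun k => ?_) hlim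
  rw [← intervalIntegral.integral_const_mul, intervalIntegral.integral_of_le hcd.le,
    intervalIntegral.integral_of_le hcd.le]
  refine MeasureTheory.integral_mono_of_nonneg (Filter.Eventually.of_forall fun x => ?_)
    ((((hfi k).sub hf₀).abs.const_mul _).1) ?_
  · show 0 ≤ |f k x - f₀ x| ^ p
    positivity
  · filter_upwards [hf₀b, ae_restrict_mem measurableSet_Ioc] with x hx hxm
    have h1 := hB k x ⟨hxm.1.le, hxm.2⟩
    have h2 : |f k x - f₀ x| ≤ 2 * C := (abs_sub _ _).trans (by linarith)
    rcases (abs_nonneg (f k x - f₀ x)).eq_or_lt with h0 | h0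
    · rw [← h0, Real.zero_rpow (by linarith), mul_zero]
    · have e : |f k x - f₀ x| ^ p = |f k x - f₀ x| ^ (p - 1) * |f k x - f₀ x| := by
        rw [← Real.rpow_add_one h0.ne']; ring_nf
      rw [e]
      exact mul_le_mul_of_nonneg_right (Real.rpow_le_rpow h0.le h2 (by linarith)) h0.le
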